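/- arXiv:1202.5476 — 2 statements merged into one kernel-verified Lean document; each statement's English description precedes it below -/
import Mathlib

section
/- Let A be a unital associative ℂ-algebra, q ∈ ℂ nonzero, n = −(q + q⁻¹), and e ∈ A an element with e² = n·e. Then for every nonzero w ∈ ℂ with [qw] ≠ 0 and [q/w] ≠ 0, one has Ř(w)·Ř(1/w) = 1, i.e. ([q/w]·1 − [w]·e)·([qw]·1 − [1/w]·e) = [qw]·[q/w]·1 (unitarity of the Temperley–Lieb Ř-matrix). -/
/-- The bracket `[x] = x - x⁻¹`. -/
noncomputable def br (x : ℂ) : ℂ := x - x⁻¹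

/-- **Unitarity of the Temperley–Lieb Ř-matrix.**
Let `A` be a unital associative ℂ-algebra, `q ∈ ℂ` nonzero, `n = -(q + q⁻¹)`, and `e ∈ A`
with `e² = n·e`.  Then for every nonzero `w ∈ ℂ` with `[qw] ≠ 0` and `[q/w] ≠ 0`, one has
`([q/w]·1 − [w]·e) · ([qw]·1 − [1/w]·e) = [qw]·[q/w]·1`. -/
theorem tl_unitarity (A : Type*) [Ring A] [Algebra ℂ A]
    (q : ℂ) (hq : q ≠ 0) (e : A)
    (he : e * e = (-(q + q⁻¹)) • e)
    (w : ℂ) (hw : w ≠ 0) (h1 : br (q * w) ≠ 0) (h2 : br (q / w) ≠ 0) :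
    (br (q / w) • (1 : A) - br w • e) * (br (q * w) • (1 : A) - br w⁻¹ • e)
      = (br (q * w) * br (q / w)) • (1 : A) := by
  have hcoef : br (q / w) * br w⁻¹ + br w * br (q * w) + br w * br w⁻¹ * (q + q⁻¹) = 0 := by
    simp only [br]
    field_simp
    ring
  calc (br (q / w) • (1 : A) - br w • e) * (br (q * w) • (1 : A) - br w⁻¹ • e)
      = (br (q * w) * br (q / w)) • (1 : A)
        - (br (q / w) * br w⁻¹ + br w * br (q * w) + br w * br w⁻¹ * (q + q⁻¹)) • e := by
        simp only [sub_mul, mul_sub, smul_mul_smul_comm, one_mul, mul_one, he]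
        module
    _ = (br (q * w) * br (q / w)) • (1 : A) := by rw [hcoef, zero_smul, sub_zero]
end

section
/- Let A be a unital associative ℂ-algebra, q ∈ ℂ nonzero, n = −(q + q⁻¹), and e₁, e₂ ∈ A with e₁² = n·e₁, e₂² = n·e₂, e₁e₂e₁ = e₁ and e₂e₁e₂ = e₂. Then for all nonzero z₁, z₂, z₃ ∈ ℂ such that [q z₁/z₂], [q z₁/z₃] and [q z₂/z₃] are nonzero, the Yang–Baxter equation holds: Ř₁(z₁/z₂)·Ř₂(z₁/z₃)·Ř₁(z₂/z₃) = Ř₂(z₂/z₃)·Ř₁(z₁/z₃)·Ř₂(z₁/z₂), where Ř₁(w) = ([q/w]/[qw])·1 − ([w]/[qw])·e₁ and Ř₂(w) = ([q/w]/[qw])·1 − ([w]/[qw])·e₂. -/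
/-- The Temperley–Lieb Ř-matrix `Ř(w) = ([q/w]/[qw])·1 − ([w]/[qw])·e`. -/
noncomputable def Rcheck {A : Type*} [Ring A] [Algebra ℂ A] (q w : ℂ) (e : A) : A :=
  (br (q / w) / br (q * w)) • (1 : A) - (br w / br (q * w)) • e

/-- The scalar identity behind the Yang–Baxter equation. -/
theorem br_yang_baxter {q u v : ℂ} (hq : q ≠ 0) (hu : u ≠ 0) (hv : v ≠ 0) :
    br (q / u) * br (q / (u * v)) * br v + br u * br (q / (u * v)) * br (q / v)
      + (q + q⁻¹) * (br u * br (q / (u * v)) * br v) + br u * br (u * v) * br v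
      = br (q / u) * br (u * v) * br (q / v) := by
  unfold br
  field_simp
  ring

/-- Expansion of a triple product of linear polynomials in two elements satisfying
Temperley–Lieb relations. -/
theorem temperleyLieb_triple_product {A : Type*} [Ring A] [Algebra ℂ A] {n : ℂ} {e f : A}
    (he : e * e = n • e) (hefe : e * f * e = e) (a₁ a₂ a₃ b₁ b₂ b₃ : ℂ) :
    (a₁ • (1 : A) - b₁ • e) * (a₂ • (1 : A) - b₂ • f) * (a₃ • (1 : A) - b₃ • e)
      = (a₁ * a₂ * a₃) • (1 : A)
        - (a₁ * a₂ * b₃ + b₁ * a₂ * a₃ - n * (b₁ * a₂ * b₃) + b₁ * b₂ * b₃) • e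
        - (a₁ * b₂ * a₃) • f + (b₁ * b₂ * a₃) • (e * f) + (a₁ * b₂ * b₃) • (f * e) := by
  simp only [sub_mul, mul_sub, smul_mul_assoc, mul_smul_comm, one_mul, mul_one, he, hefe]
  module

/-- The Yang–Baxter equation in a Temperley–Lieb algebra, reduced to a scalar identity. -/
theorem temperleyLieb_yang_baxter {A : Type*} [Ring A] [Algebra ℂ A] {n : ℂ} {e f : A}
    (he : e * e = n • e) (hf : f * f = n • f) (hefe : e * f * e = e) (hfef : f * e * f = f)
    {a₁ a₂ a₃ b₁ b₂ b₃ : ℂ}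
    (h : a₁ * a₂ * b₃ + b₁ * a₂ * a₃ - n * (b₁ * a₂ * b₃) + b₁ * b₂ * b₃ = a₁ * b₂ * a₃) :
    (a₁ • (1 : A) - b₁ • e) * (a₂ • (1 : A) - b₂ • f) * (a₃ • (1 : A) - b₃ • e)
      = (a₃ • (1 : A) - b₃ • f) * (a₂ • (1 : A) - b₂ • e) * (a₁ • (1 : A) - b₁ • f) := by
  have h' : a₃ * a₂ * b₁ + b₃ * a₂ * a₁ - n * (b₃ * a₂ * b₁) + b₃ * b₂ * b₁ = a₃ * b₂ * a₁ := by
    linear_combination h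
  rw [temperleyLieb_triple_product he hefe, temperleyLieb_triple_product hf hfef, h, h']
  module

/-- **Yang–Baxter equation for the Temperley–Lieb Ř-matrix.**
Let `A` be a unital associative ℂ-algebra, `q ∈ ℂ` nonzero, `n = -(q+q⁻¹)`, and `e₁, e₂ ∈ A`
with `e₁² = n·e₁`, `e₂² = n·e₂`, `e₁e₂e₁ = e₁`, `e₂e₁e₂ = e₂`.  Then for all nonzero
`z₁, z₂, z₃` with `[q z₁/z₂]`, `[q z₁/z₃]`, `[q z₂/z₃]` nonzero,
`Ř₁(z₁/z₂)·Ř₂(z₁/z₃)·Ř₁(z₂/z₃) = Ř₂(z₂/z₃)·Ř₁(z₁/z₃)·Ř₂(z₁/z₂)`. -/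
theorem tl_yang_baxter (A : Type*) [Ring A] [Algebra ℂ A]
    (q : ℂ) (hq : q ≠ 0) (e₁ e₂ : A)
    (he₁ : e₁ * e₁ = (-(q + q⁻¹)) • e₁)
    (he₂ : e₂ * e₂ = (-(q + q⁻¹)) • e₂)
    (he121 : e₁ * e₂ * e₁ = e₁)
    (he212 : e₂ * e₁ * e₂ = e₂)
    (z₁ z₂ z₃ : ℂ) (hz₁ : z₁ ≠ 0) (hz₂ : z₂ ≠ 0) (hz₃ : z₃ ≠ 0)
    (h12 : br (q * (z₁ / z₂)) ≠ 0) (h13 : br (q * (z₁ / z₃)) ≠ 0)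
    (h23 : br (q * (z₂ / z₃)) ≠ 0) :
    Rcheck q (z₁ / z₂) e₁ * Rcheck q (z₁ / z₃) e₂ * Rcheck q (z₂ / z₃) e₁
      = Rcheck q (z₂ / z₃) e₂ * Rcheck q (z₁ / z₃) e₁ * Rcheck q (z₁ / z₂) e₂ := by
  have huv : z₁ / z₃ = z₁ / z₂ * (z₂ / z₃) := by field_simp
  have key := br_yang_baxter hq (div_ne_zero hz₁ hz₂) (div_ne_zero hz₂ hz₃)
  rw [← huv] at key
  refine temperleyLieb_yang_baxter he₁ he₂ he121 he212 ?_
  linear_combination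
    key / (br (q * (z₁ / z₂)) * br (q * (z₁ / z₃)) * br (q * (z₂ / z₃)))
end
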